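/- (Greedy progress lemma) Let x be the minimizer of Q over vectors supported on F, supp(x̄) ⊂ F̄, F̄ \ F ≠ ∅, and let j = argmax_i |∇Q(x)_i|. Then for all s ≥ |F ∪ F̄|: min_α Q(x + α·e_j) ≤ Q(x) − [ρ₋(s)·‖x − x̄‖₂² / (ρ₊(1)·(Σ_{i ∈ F̄\F} |x̄_i|)²)]·max(0, Q(x) − Q(x̄)). -/

import Mathlib

open scoped Classical

/-- `‖u‖₀`: number of nonzero coordinates. -/
noncomputable def l0 {d : ℕ} (u : Fin d → ℝ) : ℕ :=
  (Finset.univ.filter fun i => u i ≠ 0).card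

/-- `‖u‖₂`: the Euclidean norm. -/
noncomputable def l2 {d : ℕ} (u : Fin d → ℝ) : ℝ :=
  Real.sqrt (∑ i, u i ^ 2)

theorem l2_sq {d : ℕ} (u : Fin d → ℝ) : l2 u ^ 2 = ∑ i, u i ^ 2 :=
  Real.sq_sqrt (Finset.sum_nonneg fun _ _ => sq_nonneg _)

theorem l0_le_card_of_support_subset {d : ℕ} {u : Fin d → ℝ} {S : Finset (Fin d)}
    (h : ∀ i ∉ S, u i = 0) : l0 u ≤ S.card := by
  refine Finset.card_le_card fun i hi => ?_
  by_contra hiS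
  exact (Finset.mem_filter.mp hi).2 (h i hiS)

/-- Decrease achieved by the optimal step along a coordinate for a function that is smooth
along coordinate directions. -/
theorem coordinate_descent {d : ℕ} {Q : (Fin d → ℝ) → ℝ} {ρ : ℝ} (hρ : 0 < ρ)
    (hupper : ∀ u v : Fin d → ℝ, l0 (u - v) ≤ 1 →
      Q v - Q u - fderiv ℝ Q u (v - u) ≤ ρ * (l2 (u - v)) ^ 2)
    (x : Fin d → ℝ) (i : Fin d) :
    Q (x + (-fderiv ℝ Q x (Pi.single i 1) / (2 * ρ)) • (Pi.single i 1 : Fin d → ℝ)) ≤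
      Q x - fderiv ℝ Q x (Pi.single i 1) ^ 2 / (4 * ρ) := by
  set g := fderiv ℝ Q x (Pi.single i 1) with hg
  set α := -g / (2 * ρ) with hα
  have hsub : x - (x + α • (Pi.single i 1 : Fin d → ℝ)) = Pi.single i (-α) := by
    rw [← Pi.single_smul]
    simp [Pi.single_neg]
  have h0 : l0 (x - (x + α • (Pi.single i 1 : Fin d → ℝ))) ≤ 1 := by
    rw [hsub]
    simpa using l0_le_card_of_support_subset (S := {i}) (u := Pi.single i (-α))
      fun k hk => Pi.single_eq_of_ne (by simpa using hk) _
  have h := hupper _ _ h0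
  have hnorm : l2 (Pi.single i (-α) : Fin d → ℝ) ^ 2 = α ^ 2 := by
    rw [l2_sq, Finset.sum_eq_single i]
    · simp
    · intro k _ hk
      simp [Pi.single_eq_of_ne hk]
    · simp
  rw [hsub, hnorm, add_sub_cancel_left, map_smul, ← hg, smul_eq_mul] at h
  have hval : α * g + ρ * α ^ 2 = -(g ^ 2 / (4 * ρ)) := by
    rw [hα]
    field_simp
    ring
  linarith

/-- Greedy progress lemma (Lemma 3 of the paper): with `x` the minimizer of `Q` over
support `F`, `supp(x̄) ⊂ F̄`, `F̄ \ F ≠ ∅`, and `j = argmax_i |∇Q(x)_i|`, for all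
`s ≥ |F ∪ F̄|`:
`min_α Q(x + α e_j) ≤ Q(x) − [ρ₋(s)‖x−x̄‖₂²/(ρ₊(1)(Σ_{i∈F̄\F}|x̄_i|)²)]·max(0, Q(x)−Q(x̄))`. -/
theorem stmt6 (d s : ℕ) (Q : (Fin d → ℝ) → ℝ)
    (hQ : Differentiable ℝ Q) (hconv : ConvexOn ℝ Set.univ Q)
    (F Fbar : Finset (Fin d)) (xbar x : Fin d → ℝ)
    (hsupp : ∀ i ∉ Fbar, xbar i = 0)
    (hxF : ∀ i ∉ F, x i = 0)
    (hxmin : ∀ z : Fin d → ℝ, (∀ i ∉ F, z i = 0) → Q x ≤ Q z)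
    (hne : (Fbar \ F).Nonempty)
    (ρp1 ρm : ℝ) (hρp1 : 0 < ρp1) (hρm : 0 < ρm)
    (hupper1 : ∀ u v : Fin d → ℝ, l0 (u - v) ≤ 1 →
      Q v - Q u - fderiv ℝ Q u (v - u) ≤ ρp1 * (l2 (u - v)) ^ 2)
    (hlower : ∀ u v : Fin d → ℝ, l0 (u - v) ≤ s →
      ρm * (l2 (u - v)) ^ 2 ≤ Q v - Q u - fderiv ℝ Q u (v - u))
    (hscard : (F ∪ Fbar).card ≤ s)
    (j : Fin d) (hj : ∀ i, |fderiv ℝ Q x (Pi.single i 1)| ≤ |fderiv ℝ Q x (Pi.single j 1)|) :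
    ∃ α : ℝ, Q (x + α • (Pi.single j 1 : Fin d → ℝ)) ≤
      Q x - (ρm * (l2 (x - xbar)) ^ 2 / (ρp1 * (∑ i ∈ Fbar \ F, |xbar i|) ^ 2)) *
        max 0 (Q x - Q xbar) := by
  set g : Fin d → ℝ := fun i => fderiv ℝ Q x (Pi.single i 1) with hg
  have hstat : ∀ i ∈ F, g i = 0 := by
    intro i hi
    have hdesc := coordinate_descent hρp1 hupper1 x i
    have hmin := hxmin (x + (-g i / (2 * ρp1)) • (Pi.single i 1 : Fin d → ℝ)) fun k hk => by
      have hki : k ≠ i := fun h => hk (h ▸ hi)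
      simp [hxF k hk, hki]
    have hle : g i ^ 2 / (4 * ρp1) ≤ 0 := by
      simp only [hg] at hmin ⊢
      linarith
    by_contra hne0
    have : 0 < g i ^ 2 / (4 * ρp1) := by positivity
    linarith
  set S := ∑ i ∈ Fbar \ F, |xbar i| with hS
  have hexpand : fderiv ℝ Q x (xbar - x) = ∑ i ∈ Fbar \ F, xbar i * g i := by
    have hsum : fderiv ℝ Q x (xbar - x) = ∑ i, (xbar - x) i * g i := by
      conv_lhs => rw [pi_eq_sum_univ' (xbar - x)]
      simp only [map_sum, map_smul, smul_eq_mul, hg]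
    rw [hsum, ← Finset.sum_subset (Finset.subset_univ (Fbar \ F))]
    · refine Finset.sum_congr rfl fun i hi => ?_
      simp [hxF i (Finset.mem_sdiff.mp hi).2]
    · intro i _ hi
      by_cases hiF : i ∈ F
      · simp [hstat i hiF]
      · have hib : i ∉ Fbar := fun h => hi (Finset.mem_sdiff.mpr ⟨h, hiF⟩)
        simp [hsupp i hib, hxF i hiF]
  have hbound : -fderiv ℝ Q x (xbar - x) ≤ S * |g j| := by
    rw [hexpand, hS, Finset.sum_mul]
    refine (neg_le_abs _).trans ((Finset.abs_sum_le_sum_abs _ _).trans ?_)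
    refine Finset.sum_le_sum fun i _ => ?_
    rw [abs_mul]
    exact mul_le_mul_of_nonneg_left (hj i) (abs_nonneg _)
  have hstrong := hlower x xbar <| (l0_le_card_of_support_subset (S := F ∪ Fbar) fun i hi => by
    rw [Finset.mem_union, not_or] at hi
    simp [hsupp i hi.2, hxF i hi.1]).trans hscard
  refine ⟨-g j / (2 * ρp1), (coordinate_descent hρp1 hupper1 x j).trans ?_⟩
  refine sub_le_sub_left ?_ _
  change _ ≤ g j ^ 2 / (4 * ρp1)
  have hS0 : 0 ≤ S := Finset.sum_nonneg fun _ _ => abs_nonneg _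
  rcases le_or_gt (Q x - Q xbar) 0 with hgap | hgap
  · rw [max_eq_left hgap, mul_zero]
    positivity
  rw [max_eq_right hgap.le]
  rcases hS0.eq_or_lt with hS00 | hSpos
  · rw [← hS00]
    simp only [ne_eq, OfNat.ofNat_ne_zero, not_false_eq_true, zero_pow, mul_zero, div_zero,
      zero_mul]
    positivity
  set a := ρm * l2 (x - xbar) ^ 2 with ha
  have ha0 : 0 ≤ a := by positivity
  have hsq : 4 * a * (Q x - Q xbar) ≤ S ^ 2 * g j ^ 2 := by
    have h1 : a + (Q x - Q xbar) ≤ S * |g j| := by linarith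
    have h2 := pow_le_pow_left₀ (by positivity) h1 2
    rw [mul_pow, sq_abs] at h2
    linarith [sq_nonneg (a - (Q x - Q xbar))]
  rw [div_mul_eq_mul_div, div_le_div_iff₀ (by positivity) (by positivity)]
  linarith [mul_le_mul_of_nonneg_left hsq hρp1.le]
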